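/- arXiv:2405.14454 — 3 statements merged into one kernel-verified Lean document; each statement's English description precedes it below -/
import Mathlib

section
/- The first-level Paperfolding sequence agrees with the image under the coding π (with π(A)=0, π(B)=0, π(C)=1, π(D)=1) of the fixed point of the uniform 2-morphism ψ on the alphabet {A,B,C,D} given by ψ(A)=AB, ψ(B)=CB, ψ(C)=AD, ψ(D)=CD, starting from the prolongable letter A. -/
/-- The `n`-th level Paperfolding sequence. -/
def paperfolding (n i : ℕ) : ℕ :=
  ((i / 2 ^ (padicValNat 2 i)) % 2 ^ (n + 1) - 1) / 2

/-- The alphabet `{A, B, C, D}`. -/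
inductive Γ | A | B | C | D
  deriving DecidableEq

open Γ in
/-- The uniform 2-morphism `ψ`. -/
def ψ : Γ → List Γ
  | A => [A, B]
  | B => [C, B]
  | C => [A, D]
  | D => [C, D]

open Γ in
/-- The coding `π`. -/
def πcode : Γ → ℕ
  | A => 0
  | B => 0
  | C => 1
  | D => 1

theorem paperfolding_two_mul (n : ℕ) {i : ℕ} (hi : i ≠ 0) :
    paperfolding n (2 * i) = paperfolding n i := by
  have hν : padicValNat 2 (2 * i) = padicValNat 2 i + 1 := by
    rw [padicValNat.mul two_ne_zero hi, padicValNat.self one_lt_two, add_comm]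
  rw [paperfolding, paperfolding, hν, pow_succ', Nat.mul_div_mul_left _ _ two_pos]

theorem paperfolding_one_two_mul_add_one (m : ℕ) :
    paperfolding 1 (2 * m + 1) = m % 2 := by
  have hν : padicValNat 2 (2 * m + 1) = 0 :=
    padicValNat.eq_zero_of_not_dvd (by omega)
  rw [paperfolding, hν]
  norm_num
  omega

/-- The letters `A` and `C` occur exactly at the even positions of a fixed point of `ψ`. -/
theorem eq_A_or_C_iff_even {f : ℕ → Γ}
    (hfix : ∀ j : ℕ, ψ (f j) = [f (2 * j), f (2 * j + 1)]) (j : ℕ) :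
    f j = Γ.A ∨ f j = Γ.C ↔ Even j := by
  obtain ⟨m, rfl | rfl⟩ := Nat.even_or_odd' j <;> have h := hfix m <;>
    cases hm : f m <;> simp only [hm, ψ, List.cons.injEq] at h <;>
    simp [← h.1, ← h.2.1]

/-- At even positions, a fixed point of `ψ` codes to the parity of half the position. -/
theorem πcode_two_mul {f : ℕ → Γ}
    (hfix : ∀ j : ℕ, ψ (f j) = [f (2 * j), f (2 * j + 1)]) (m : ℕ) :
    πcode (f (2 * m)) = m % 2 := by
  have h := hfix m
  have hp := eq_A_or_C_iff_even hfix m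
  rw [Nat.even_iff] at hp
  cases hm : f m <;> simp only [hm, ψ, List.cons.injEq] at h hp <;>
    rw [← h.1] <;> simp [πcode] at hp ⊢ <;> omega

theorem πcode_two_mul_add_one {f : ℕ → Γ}
    (hfix : ∀ j : ℕ, ψ (f j) = [f (2 * j), f (2 * j + 1)]) (m : ℕ) :
    πcode (f (2 * m + 1)) = πcode (f m) := by
  have h := hfix m
  cases hm : f m <;> simp only [hm, ψ, List.cons.injEq] at h <;> rw [← h.2.1] <;> rfl

/-- The first-level Paperfolding sequence is the image under `π` of the fixed
point of `ψ` starting from the prolongable letter `A`: any `f : ℕ → Γ` with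
`f 0 = A` and `ψ (f j) = [f (2j), f (2j+1)]` (i.e. `f` is the fixed point
`ψ^ω(A)`) codes to the paperfolding sequence. -/
theorem paperfolding_one_automatic (f : ℕ → Γ) (h0 : f 0 = Γ.A)
    (hfix : ∀ j : ℕ, ψ (f j) = [f (2 * j), f (2 * j + 1)]) :
    ∀ j : ℕ, paperfolding 1 (j + 1) = πcode (f j) := by
  intro j
  induction j using Nat.strong_induction_on with
  | _ j ih =>
    obtain ⟨m, rfl | rfl⟩ := Nat.even_or_odd' j
    · rw [paperfolding_one_two_mul_add_one, πcode_two_mul hfix]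
    · rw [show 2 * m + 1 + 1 = 2 * (m + 1) by ring, paperfolding_two_mul 1 m.succ_ne_zero,
        πcode_two_mul_add_one hfix, ih m (by omega)]
end

section
/- Let K be a finite field, let p(t) ∈ K[t] be irreducible of degree m, and let Θ(t) = Σ_{i≥1} a_i t^{-i} ∈ K((t^{-1})). If inf over nonzero N(t) ∈ K[t] of |N(t)|·|N(t)|_t·⟨N(t)·Θ(t)⟩ equals q^{-l} for a positive integer l (where q = |K|), then the series Θ(p(t)) = Σ_{i≥1} a_i p(t)^{-i} satisfies inf over nonzero N(t) of |N(t)|·|N(t)|_{p(t)}·⟨N(t)·Θ(p(t))⟩ = q^{-lm}. -/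
open scoped Classical

noncomputable section

variable {K : Type*} [Field K]

/-- The element `t` of `K((t^{-1}))`.  We realise `K((t^{-1}))` as the field of
Laurent series `K⸨X⸩` in the variable `X = t^{-1}`, so `t = X^{-1}` is the
Hahn series `single (-1) 1`. -/
def tElem : LaurentSeries K := HahnSeries.single (-1 : ℤ) 1

/-- A polynomial `N(t) ∈ K[t]` viewed inside `K((t^{-1}))`. -/
def polyToL (N : Polynomial K) : LaurentSeries K := Polynomial.aeval tElem N

/-- The Laurent series `Θ(t) = Σ_{i≥1} a_i t^{-i}` with coefficient sequence `a`. -/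
def theta (a : ℕ → K) : LaurentSeries K :=
  HahnSeries.ofPowerSeries ℤ K (PowerSeries.mk fun i => if i = 0 then 0 else a i)

/-- The substituted series `Θ(p(t)) = Σ_{i≥1} a_i p(t)^{-i}`, an element of
`K((t^{-1}))` since `deg p ≥ 1` makes the sum converge. -/
def thetaSubst (a : ℕ → K) (p : Polynomial K) : LaurentSeries K :=
  ∑' i : ℕ, a (i + 1) • (polyToL p ^ (-(i + 1 : ℤ)))

/-- `⟨f⟩ = q^{-min{i ≥ 1 : coefficient of t^{-i} in f ≠ 0}}`, the norm of the
fractional (negative-degree in `t`) part of `f ∈ K((t^{-1}))`; it is `0` when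
the fractional part vanishes. -/
def lFracNorm (q : ℕ) (f : LaurentSeries K) : ℝ :=
  if h : ∃ i : ℕ, 1 ≤ i ∧ f.coeff (i : ℤ) ≠ 0 then (q : ℝ) ^ (-(Nat.find h : ℤ)) else 0

/-- The `t`-adic Littlewood quantity `|N|·|N|_t·⟨N·Θ⟩`, where `|N| = q^{deg N}`
and `|N|_t = q^{-ν_t(N)}` with `ν_t(N)` the trailing degree of `N`. -/
def qtyT (q : ℕ) (a : ℕ → K) (N : Polynomial K) : ℝ :=
  (q : ℝ) ^ (N.natDegree : ℤ) * (q : ℝ) ^ (-(N.natTrailingDegree : ℤ)) *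
    lFracNorm q (polyToL N * theta a)

/-- The `p(t)`-adic Littlewood quantity `|N|·|N|_{p(t)}·⟨N·Θ(p(t))⟩`, where
`|N|_{p(t)} = (q^m)^{-ν_{p(t)}(N)}` with `m = deg p` and `ν_{p(t)}(N)` the
`p(t)`-adic valuation of `N`. -/
def qtyP (q : ℕ) (a : ℕ → K) (p N : Polynomial K) : ℝ :=
  (q : ℝ) ^ (N.natDegree : ℤ) *
    ((q : ℝ) ^ (p.natDegree : ℤ)) ^ (-(multiplicity p N : ℤ)) *
    lFracNorm q (polyToL N * thetaSubst a p)

theorem polyToL_coeff (N : Polynomial K) (d : ℤ) :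
    (polyToL N).coeff d = if d ≤ 0 then N.coeff (-d).toNat else 0 := by
  unfold polyToL tElem
  induction N using Polynomial.induction_on' with
  | add f g hf hg =>
    rw [map_add, HahnSeries.coeff_add, hf, hg]
    split_ifs <;> simp
  | monomial n c =>
    rw [Polynomial.aeval_monomial, LaurentSeries.algebraMap_apply, HahnSeries.single_pow,
      HahnSeries.C_apply, HahnSeries.single_mul_single, HahnSeries.coeff_single,
      Polynomial.coeff_monomial]
    simp only [one_pow, mul_one, nsmul_eq_mul, zero_add]
    split_ifs <;> first | rfl | omega

theorem polyToL_C_mul (c : K) (x : LaurentSeries K) : polyToL (Polynomial.C c) * x = c • x := by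
  rw [polyToL, Polynomial.aeval_C, LaurentSeries.algebraMap_apply, HahnSeries.C_mul_eq_smul]

theorem polyToL_coeff_of_pos (N : Polynomial K) {d : ℤ} (hd : 0 < d) :
    (polyToL N).coeff d = 0 := by
  rw [polyToL_coeff, if_neg hd.not_ge]

theorem polyToL_ne_zero {N : Polynomial K} (hN : N ≠ 0) : polyToL N ≠ 0 := by
  intro h
  have := polyToL_coeff N (-N.natDegree)
  simp [h] at this
  exact hN (Polynomial.leadingCoeff_eq_zero.1 this.symm)

theorem polyToL_order {N : Polynomial K} (hN : N ≠ 0) :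
    (polyToL N).order = -(N.natDegree : ℤ) := by
  refine le_antisymm (HahnSeries.order_le_of_coeff_ne_zero ?_)
    ((HahnSeries.le_order_iff_forall (polyToL_ne_zero hN)).2 fun d hd => ?_)
  · simpa [polyToL_coeff] using hN
  · rw [polyToL_coeff, if_pos (by omega)]
    exact Polynomial.coeff_eq_zero_of_natDegree_lt (by omega)

theorem polyToL_zpow_neg_order {N : Polynomial K} (hN : N ≠ 0) (n : ℕ) :
    (polyToL N ^ (-(n : ℤ))).order = n * N.natDegree := by
  have h0 := polyToL_ne_zero hN
  have h := HahnSeries.order_mul (zpow_ne_zero (-(n : ℤ)) h0) (pow_ne_zero n h0)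
  rw [zpow_neg, zpow_natCast, inv_mul_cancel₀ (pow_ne_zero n h0), HahnSeries.order_one,
    HahnSeries.order_pow, polyToL_order hN] at h
  rw [zpow_neg, zpow_natCast]
  simp at h
  linarith

theorem thetaSubst_term_coeff_eq_zero (a : ℕ → K) {p : Polynomial K} (hp : p ≠ 0) (j : ℕ) {d : ℤ}
    (hd : d < (j + 1) * p.natDegree) :
    (a (j + 1) • (polyToL p ^ (-(j + 1 : ℤ)))).coeff d = 0 := by
  have := polyToL_zpow_neg_order hp (j + 1)
  push_cast at this
  rw [HahnSeries.coeff_smul, HahnSeries.coeff_eq_zero_of_lt_order (by rwa [this]), smul_zero]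

theorem summable_thetaSubst (a : ℕ → K) {p : Polynomial K} (hp : 0 < p.natDegree) :
    Summable fun j : ℕ => a (j + 1) • (polyToL p ^ (-(j + 1 : ℤ))) := by
  have hp0 : p ≠ 0 := by rintro rfl; simp at hp
  have : NonarchimedeanRing (LaurentSeries K) := (Valuation.subgroups_basis _).nonarchimedean
  apply NonarchimedeanAddGroup.summable_of_tendsto_cofinite_zero
  rw [Nat.cofinite_eq_atTop]
  intro s hs
  obtain ⟨γ, hγ⟩ := Valued.mem_nhds_zero.1 hs
  have hγ0 : MonoidWithZeroHom.ValueGroup₀.embedding γ.1 ≠ 0 := by simp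
  obtain ⟨k, hk⟩ := WithZero.ne_zero_iff_exists.1 hγ0
  refine Filter.mem_map.2 (Filter.mem_atTop_sets.2 ⟨(1 - k.toAdd).toNat, fun j hj => hγ ?_⟩)
  change Valued.v.restrict _ < γ.1
  rw [Valuation.restrict_lt_iff_lt_embedding, ← hk]
  refine lt_of_le_of_lt ((LaurentSeries.valuation_le_iff_coeff_lt_eq_zero K (D := (j + 1 : ℤ))).2
    fun n hn => thetaSubst_term_coeff_eq_zero a hp0 j ?_) ?_
  · have : (1 : ℤ) ≤ p.natDegree := by exact_mod_cast hp
    nlinarith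
  · rw [WithZero.exp, WithZero.coe_lt_coe, ← Multiplicative.toAdd_lt]
    simp
    omega

theorem hasSum_thetaSubst_coeff (a : ℕ → K) {p : Polynomial K} (hp : 0 < p.natDegree) (d : ℤ) :
    let _ : TopologicalSpace K := ⊥
    HasSum (fun j : ℕ => (a (j + 1) • (polyToL p ^ (-(j + 1 : ℤ)))).coeff d)
      ((thetaSubst a p).coeff d) := by
  let _ : UniformSpace K := ⊥
  exact (summable_thetaSubst a hp).hasSum.map (HahnSeries.coeff.addMonoidHom d)
    (LaurentSeries.uniformContinuous_coeff (K := K) d).continuous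

theorem theta_coeff (a : ℕ → K) {i : ℕ} (hi : 1 ≤ i) : (theta a).coeff (i : ℤ) = a i := by
  rw [theta, LaurentSeries.coeff_coe_powerSeries, PowerSeries.coeff_mk, if_neg (by omega)]

theorem theta_coeff_of_nonpos (a : ℕ → K) {d : ℤ} (hd : d ≤ 0) : (theta a).coeff d = 0 := by
  rw [theta, PowerSeries.coeff_coe]
  split_ifs with h
  · rfl
  · simp; omega

theorem theta_ext {a : ℕ → K} {x : LaurentSeries K} (h0 : ∀ d : ℤ, d ≤ 0 → x.coeff d = 0)
    (h1 : ∀ i : ℕ, 1 ≤ i → x.coeff (i : ℤ) = a i) : x = theta a := by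
  ext d
  rcases le_or_gt d 0 with hd | hd
  · rw [h0 d hd, theta_coeff_of_nonpos a hd]
  · obtain ⟨i, rfl⟩ := Int.eq_ofNat_of_zero_le hd.le
    have hi : 1 ≤ i := by omega
    exact (h1 i hi).trans (theta_coeff a hi).symm

theorem theta_add (a b : ℕ → K) : theta (a + b) = theta a + theta b := by
  refine (theta_ext (fun d hd => ?_) fun i hi => ?_).symm
  · simp [theta_coeff_of_nonpos _ hd]
  · simp [theta_coeff _ hi]

theorem theta_smul (c : K) (a : ℕ → K) : theta (c • a) = c • theta a := by
  refine (theta_ext (fun d hd => ?_) fun i hi => ?_).symm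
  · simp [theta_coeff_of_nonpos _ hd]
  · simp [theta_coeff _ hi]

theorem polyToL_X_mul_theta (a : ℕ → K) :
    polyToL Polynomial.X * theta a =
      polyToL (Polynomial.C (a 1)) + theta (fun i => a (i + 1)) := by
  rw [← sub_eq_iff_eq_add']
  have key : ∀ d : ℤ, (polyToL Polynomial.X * theta a).coeff d = (theta a).coeff (d + 1) := by
    intro d
    have := HahnSeries.coeff_single_mul_add (r := (1 : K)) (x := theta a) (a := d + 1) (b := -1)
    simpa [polyToL, tElem] using this
  refine theta_ext (fun d hd => ?_) fun i hi => ?_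
  · rw [HahnSeries.coeff_sub, key, polyToL_coeff, if_pos hd, Polynomial.coeff_C]
    rcases hd.lt_or_eq with h | rfl
    · rw [theta_coeff_of_nonpos _ (by omega), if_neg (by omega), sub_zero]
    · have := theta_coeff a le_rfl
      simp_all
  · rw [HahnSeries.coeff_sub, key, polyToL_coeff_of_pos _ (by omega), sub_zero]
    exact_mod_cast theta_coeff a (i := i + 1) (by omega)

theorem thetaSubst_add (a b : ℕ → K) {p : Polynomial K} (hp : 0 < p.natDegree) :
    thetaSubst (a + b) p = thetaSubst a p + thetaSubst b p := by
  unfold thetaSubst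
  rw [← (summable_thetaSubst a hp).tsum_add (summable_thetaSubst b hp)]
  simp only [Pi.add_apply, add_smul]

theorem polyToL_mul_thetaSubst (a : ℕ → K) {p : Polynomial K} (hp : 0 < p.natDegree) :
    polyToL p * thetaSubst a p = polyToL (Polynomial.C (a 1)) + thetaSubst (fun i => a (i + 1)) p := by
  have hp0 : polyToL p ≠ 0 := polyToL_ne_zero (by rintro rfl; simp at hp)
  unfold thetaSubst
  rw [← (summable_thetaSubst a hp).tsum_mul_left,
    ((summable_thetaSubst a hp).mul_left _).tsum_eq_zero_add]
  simp only [← polyToL_C_mul, mul_left_comm (polyToL p)]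
  congr 1
  · simp [hp0]
  · congr 1
    ext1 j
    rw [← zpow_one_add₀ hp0]
    push_cast
    ring_nf

theorem thetaSubst_smul (c : K) (a : ℕ → K) {p : Polynomial K} (hp : 0 < p.natDegree) :
    thetaSubst (c • a) p = c • thetaSubst a p := by
  unfold thetaSubst
  simp only [Pi.smul_apply, smul_eq_mul, mul_smul]
  rw [← polyToL_C_mul, ← (summable_thetaSubst a hp).tsum_mul_left]
  simp only [polyToL_C_mul]

theorem exists_polyToL_mul_theta_eq {p : Polynomial K} (hp : 0 < p.natDegree) (N : Polynomial K)
    (a : ℕ → K) : ∃ (G : Polynomial K) (b : ℕ → K),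
      polyToL N * theta a = polyToL G + theta b ∧
      polyToL (N.comp p) * thetaSubst a p = polyToL (G.comp p) + thetaSubst b p := by
  induction N using Polynomial.induction_on generalizing a with
  | C c =>
    refine ⟨0, c • a, ?_, ?_⟩
    · rw [theta_smul, polyToL_C_mul, polyToL, map_zero, zero_add]
    · rw [thetaSubst_smul c a hp, Polynomial.C_comp, polyToL_C_mul, Polynomial.zero_comp, polyToL,
        map_zero, zero_add]
  | add f g hf hg =>
    obtain ⟨G, b, h1, h2⟩ := hf a
    obtain ⟨G', b', h1', h2'⟩ := hg a
    refine ⟨G + G', b + b', ?_, ?_⟩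
    · rw [theta_add]
      simp only [polyToL, map_add] at *
      linear_combination h1 + h1'
    · rw [thetaSubst_add _ _ hp]
      simp only [polyToL, map_add, Polynomial.add_comp] at *
      linear_combination h2 + h2'
  | monomial n c ih =>
    obtain ⟨G, b, h1, h2⟩ := ih fun i => a (i + 1)
    refine ⟨G + Polynomial.C c * Polynomial.X ^ n * Polynomial.C (a 1), b, ?_, ?_⟩
    · have h := polyToL_X_mul_theta a
      rw [pow_succ, ← mul_assoc]
      simp only [polyToL, map_add, map_mul] at *
      linear_combination h1 + Polynomial.aeval tElem (Polynomial.C c) *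
        Polynomial.aeval tElem (Polynomial.X ^ n : Polynomial K) * h
    · have h := polyToL_mul_thetaSubst a hp
      rw [pow_succ, ← mul_assoc]
      simp only [polyToL, map_add, map_mul, Polynomial.add_comp, Polynomial.mul_comp,
        Polynomial.X_comp, Polynomial.C_comp] at *
      linear_combination h2 + Polynomial.aeval tElem (Polynomial.C c) *
        Polynomial.aeval tElem ((Polynomial.X ^ n).comp p) * h

/-- `i` is the least positive index with `b i ≠ 0`. -/
def IsLeadIndex (b : ℕ → K) (i : ℕ) : Prop :=
  1 ≤ i ∧ b i ≠ 0 ∧ ∀ j, 1 ≤ j → j < i → b j = 0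

theorem forall_eq_zero_or_exists_isLeadIndex (b : ℕ → K) :
    (∀ j, 1 ≤ j → b j = 0) ∨ ∃ i, IsLeadIndex b i := by
  by_cases! h : ∃ j, 1 ≤ j ∧ b j ≠ 0
  · refine Or.inr ⟨Nat.find h, (Nat.find_spec h).1, (Nat.find_spec h).2, fun j hj hlt => ?_⟩
    by_contra hb
    exact Nat.find_min h hlt ⟨hj, hb⟩
  · exact Or.inl h

theorem thetaSubst_coeff (b : ℕ → K) {p : Polynomial K} (hp : 0 < p.natDegree) {i : ℕ} (hi : 1 ≤ i)
    (hb : ∀ j, 1 ≤ j → j < i → b j = 0) {d : ℤ} (hd : d < (i + 1) * p.natDegree) :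
    (thetaSubst b p).coeff d = b i * (polyToL p ^ (-(i : ℤ))).coeff d := by
  let _ : TopologicalSpace K := ⊥
  have : DiscreteTopology K := ⟨rfl⟩
  have hp0 : p ≠ 0 := by rintro rfl; simp at hp
  obtain ⟨i, rfl⟩ := Nat.exists_eq_add_of_le' hi
  refine (hasSum_thetaSubst_coeff b hp d).unique ?_
  convert hasSum_single i fun j hj => ?_ using 1
  · rw [HahnSeries.coeff_smul, smul_eq_mul]
    push_cast
    rfl
  · rcases hj.lt_or_gt with h | h
    · rw [hb (j + 1) (by omega) (by omega), zero_smul, HahnSeries.coeff_zero]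
    · refine thetaSubst_term_coeff_eq_zero b hp0 j (hd.trans_le ?_)
      gcongr
      omega

theorem IsLeadIndex.thetaSubst_coeff_eq_zero {b : ℕ → K} {i : ℕ} (h : IsLeadIndex b i)
    {p : Polynomial K} (hp : 0 < p.natDegree) {d : ℤ} (hd : d < i * p.natDegree) :
    (thetaSubst b p).coeff d = 0 := by
  have hp0 : p ≠ 0 := by rintro rfl; simp at hp
  rw [thetaSubst_coeff b hp h.1 h.2.2 (by linarith), HahnSeries.coeff_eq_zero_of_lt_order, mul_zero]
  rwa [polyToL_zpow_neg_order hp0]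

theorem IsLeadIndex.thetaSubst_coeff_ne_zero {b : ℕ → K} {i : ℕ} (h : IsLeadIndex b i)
    {p : Polynomial K} (hp : 0 < p.natDegree) :
    (thetaSubst b p).coeff (i * p.natDegree) ≠ 0 := by
  have hp0 : p ≠ 0 := by rintro rfl; simp at hp
  rw [thetaSubst_coeff b hp h.1 h.2.2 (by linarith), ← polyToL_zpow_neg_order hp0]
  exact mul_ne_zero h.2.1
    (HahnSeries.coeff_order_eq_zero.not.2 (zpow_ne_zero _ (polyToL_ne_zero hp0)))

theorem thetaSubst_eq_zero {b : ℕ → K} (h : ∀ j, 1 ≤ j → b j = 0) (p : Polynomial K) :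
    thetaSubst b p = 0 := by
  simp [thetaSubst, h]

theorem zpow_neg_le_lFracNorm {q : ℕ} (hq : 1 ≤ q) {f : LaurentSeries K} {i : ℕ} (hi : 1 ≤ i)
    (hf : f.coeff (i : ℤ) ≠ 0) : (q : ℝ) ^ (-(i : ℤ)) ≤ lFracNorm q f := by
  have h : ∃ i : ℕ, 1 ≤ i ∧ f.coeff (i : ℤ) ≠ 0 := ⟨i, hi, hf⟩
  rw [lFracNorm, dif_pos h]
  refine zpow_le_zpow_right₀ (by exact_mod_cast hq) ?_
  have := Nat.find_min' h ⟨hi, hf⟩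
  omega

theorem lFracNorm_eq {f : LaurentSeries K} {i : ℕ} (q : ℕ) (hi : 1 ≤ i) (hf : f.coeff (i : ℤ) ≠ 0)
    (hlt : ∀ j : ℕ, 1 ≤ j → j < i → f.coeff (j : ℤ) = 0) :
    lFracNorm q f = (q : ℝ) ^ (-(i : ℤ)) := by
  have h : ∃ i : ℕ, 1 ≤ i ∧ f.coeff (i : ℤ) ≠ 0 := ⟨i, hi, hf⟩
  have hfind : Nat.find h = i :=
    (Nat.find_eq_iff h).2 ⟨⟨hi, hf⟩, fun j hj hc => hc.2 (hlt j hc.1 hj)⟩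
  rw [lFracNorm, dif_pos h, hfind]

theorem lFracNorm_nonneg (q : ℕ) (f : LaurentSeries K) : 0 ≤ lFracNorm q f := by
  unfold lFracNorm
  split_ifs <;> positivity

theorem polyToL_add_theta_coeff (G : Polynomial K) (b : ℕ → K) {i : ℕ} (hi : 1 ≤ i) :
    (polyToL G + theta b).coeff (i : ℤ) = b i := by
  rw [HahnSeries.coeff_add, polyToL_coeff_of_pos _ (by omega), theta_coeff b hi, zero_add]

theorem lFracNorm_polyToL_add_theta_eq_zero (q : ℕ) (G : Polynomial K) {b : ℕ → K}
    (h : ∀ j, 1 ≤ j → b j = 0) : lFracNorm q (polyToL G + theta b) = 0 := by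
  rw [lFracNorm, dif_neg]
  rintro ⟨i, hi, hc⟩
  exact hc ((polyToL_add_theta_coeff G b hi).trans (h i hi))

theorem IsLeadIndex.lFracNorm_polyToL_add_theta {b : ℕ → K} {i : ℕ} (h : IsLeadIndex b i) (q : ℕ)
    (G : Polynomial K) : lFracNorm q (polyToL G + theta b) = (q : ℝ) ^ (-(i : ℤ)) :=
  lFracNorm_eq q h.1 (by rw [polyToL_add_theta_coeff _ _ h.1]; exact h.2.1) fun j hj hlt => by
    rw [polyToL_add_theta_coeff _ _ hj, h.2.2 j hj hlt]

theorem IsLeadIndex.lFracNorm_polyToL_add_thetaSubst {b : ℕ → K} {i : ℕ} (h : IsLeadIndex b i)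
    (q : ℕ) (G : Polynomial K) {p : Polynomial K} (hp : 0 < p.natDegree) :
    lFracNorm q (polyToL G + thetaSubst b p) = (q : ℝ) ^ (-((i * p.natDegree : ℕ) : ℤ)) := by
  have hpos : 1 ≤ i * p.natDegree := Nat.mul_pos h.1 hp
  refine lFracNorm_eq q hpos ?_ fun j hj hlt => ?_
  · rw [HahnSeries.coeff_add, polyToL_coeff_of_pos _ (by omega), zero_add]
    exact_mod_cast h.thetaSubst_coeff_ne_zero hp
  · rw [HahnSeries.coeff_add, polyToL_coeff_of_pos _ (by omega), zero_add]
    exact h.thetaSubst_coeff_eq_zero hp (by exact_mod_cast hlt)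

theorem polyToL_X_pow_mul_coeff (s : ℕ) (x : LaurentSeries K) (d : ℤ) :
    (polyToL (Polynomial.X ^ s) * x).coeff d = x.coeff (d + s) := by
  have := HahnSeries.coeff_single_mul_add (r := (1 : K)) (x := x) (a := d + s) (b := -s)
  rw [polyToL, map_pow, Polynomial.aeval_X, tElem, HahnSeries.single_pow]
  simpa using this

theorem IsLeadIndex.le_lFracNorm_sum {q : ℕ} (hq : 1 ≤ q) {p : Polynomial K}
    (hp : 0 < p.natDegree) (G : ℕ → Polynomial K) (b : ℕ → ℕ → K) {s₀ i₀ : ℕ}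
    (hs₀ : s₀ < p.natDegree) (h₀ : IsLeadIndex (b s₀) i₀) :
    (q : ℝ) ^ (-((i₀ * p.natDegree : ℕ) : ℤ)) ≤
      lFracNorm q (∑ s ∈ Finset.range p.natDegree,
        polyToL (Polynomial.X ^ s) * (polyToL (G s) + thetaSubst (b s) p)) := by
  have hex : ∀ s, ∃ i, (∀ j, 1 ≤ j → b s j = 0) ∨ IsLeadIndex (b s) i := fun s =>
    (forall_eq_zero_or_exists_isLeadIndex (b s)).elim (fun h => ⟨0, Or.inl h⟩)
      fun ⟨i, hi⟩ => ⟨i, Or.inr hi⟩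
  choose i hi using hex
  have hi₀ : IsLeadIndex (b s₀) (i s₀) :=
    (hi s₀).resolve_left fun h => h₀.2.1 (h i₀ h₀.1)
  have hii : i s₀ ≤ i₀ := by
    by_contra! hlt
    exact h₀.2.1 (hi₀.2.2 i₀ h₀.1 hlt)
  set m := p.natDegree with hm
  let S := (Finset.range m).filter fun s => IsLeadIndex (b s) (i s)
  obtain ⟨s₁, hs₁, hmin⟩ := S.exists_min_image (fun s => i s * m - s)
    ⟨s₀, Finset.mem_filter.2 ⟨Finset.mem_range.2 hs₀, hi₀⟩⟩
  have hle₀ := hmin s₀ (Finset.mem_filter.2 ⟨Finset.mem_range.2 hs₀, hi₀⟩)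
  obtain ⟨hs₁m, hi₁⟩ := Finset.mem_filter.1 hs₁
  rw [Finset.mem_range] at hs₁m
  have hge : ∀ s, IsLeadIndex (b s) (i s) → m ≤ i s * m := fun s h =>
    Nat.le_mul_of_pos_left m h.1
  have hge₁ := hge s₁ hi₁
  refine le_trans ?_ (zpow_neg_le_lFracNorm hq (i := i s₁ * m - s₁) (by omega) ?_)
  · refine zpow_le_zpow_right₀ (by exact_mod_cast hq) ?_
    have := Nat.mul_le_mul_right m hii
    omega
  · have hcoeff : ∀ s, (polyToL (Polynomial.X ^ s) *
        (polyToL (G s) + thetaSubst (b s) p)).coeff ((i s₁ * m - s₁ : ℕ) : ℤ) =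
        (thetaSubst (b s) p).coeff ((i s₁ * m - s₁ + s : ℕ) : ℤ) := fun s => by
      rw [polyToL_X_pow_mul_coeff, HahnSeries.coeff_add, polyToL_coeff_of_pos _ (by omega),
        zero_add, Nat.cast_add]
    rw [HahnSeries.coeff_sum, Finset.sum_eq_single s₁]
    · rw [hcoeff, Nat.sub_add_cancel (by omega)]
      exact_mod_cast hi₁.thetaSubst_coeff_ne_zero hp
    · intro s hs hne
      rw [hcoeff]
      rcases hi s with h | h
      · rw [thetaSubst_eq_zero h, HahnSeries.coeff_zero]
      · have hle := hmin s (Finset.mem_filter.2 ⟨hs, h⟩)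
        have hges := hge s h
        rw [Finset.mem_range] at hs
        refine h.thetaSubst_coeff_eq_zero hp ?_
        rw [← hm]
        norm_cast
        refine lt_of_le_of_ne (by omega) fun heq => hne ?_
        have h1 : i s₁ * m + s = i s * m + s₁ := by omega
        have h2 := congrArg (· % m) h1
        simpa [Nat.mul_add_mod', Nat.mod_eq_of_lt hs, Nat.mod_eq_of_lt hs₁m] using h2
    · exact fun h => absurd (Finset.mem_range.2 hs₁m) h

/-- Digits of `M` in base `p`, regrouped by powers of `t`. -/
theorem exists_sum_X_pow_mul_comp {p : Polynomial K} (hp : 0 < p.natDegree) (M : Polynomial K) :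
    ∃ c : ℕ → Polynomial K,
      M = ∑ s ∈ Finset.range p.natDegree, Polynomial.X ^ s * (c s).comp p ∧
      ∀ s, p.natDegree * (c s).natDegree ≤ M.natDegree := by
  have hp0 : p ≠ 0 := by rintro rfl; simp at hp
  induction hn : M.natDegree using Nat.strong_induction_on generalizing M with
  | _ n ih =>
    have hr : (M % p).natDegree < p.natDegree := Polynomial.natDegree_mod_lt M hp.ne'
    have hsum := (M % p).as_sum_range' _ hr
    rcases lt_or_ge M.natDegree p.natDegree with hlt | hge
    · refine ⟨fun s => Polynomial.C (M.coeff s), ?_, by simp⟩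
      conv_lhs => rw [M.as_sum_range' _ hlt]
      refine Finset.sum_congr rfl fun s _ => ?_
      rw [← Polynomial.C_mul_X_pow_eq_monomial, Polynomial.C_comp, mul_comm]
    · have hM0 : M ≠ 0 := by rintro rfl; simp at hge; omega
      have hle : p.degree ≤ M.degree := by
        rw [Polynomial.degree_eq_natDegree hp0, Polynomial.degree_eq_natDegree hM0]
        exact_mod_cast hge
      have hdeg : p.natDegree + (M / p).natDegree = M.natDegree := by
        have hq : M / p ≠ 0 := by
          rw [Ne, Polynomial.div_eq_zero_iff hp0, not_lt]
          exact hle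
        have := Polynomial.degree_add_div hp0 hle
        rw [Polynomial.degree_eq_natDegree hp0, Polynomial.degree_eq_natDegree hq,
          Polynomial.degree_eq_natDegree hM0] at this
        exact_mod_cast this
      obtain ⟨c, hc, hcd⟩ := ih _ (by omega) (M / p) rfl
      refine ⟨fun s => Polynomial.X * c s + Polynomial.C ((M % p).coeff s), ?_, fun s => ?_⟩
      · conv_lhs => rw [← EuclideanDomain.div_add_mod M p, hsum, hc, Finset.mul_sum]
        rw [← Finset.sum_add_distrib]
        refine Finset.sum_congr rfl fun s _ => ?_
        rw [← Polynomial.C_mul_X_pow_eq_monomial]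
        simp
        ring
      · rw [Polynomial.natDegree_add_C]
        calc p.natDegree * (Polynomial.X * c s).natDegree
            ≤ p.natDegree * (1 + (c s).natDegree) := by
              gcongr
              exact Polynomial.natDegree_mul_le.trans (by simp)
          _ ≤ n := by
              have := hcd s
              rw [mul_add]
              omega

theorem comp_ne_zero_of_natDegree_pos {N p : Polynomial K} (hN : N ≠ 0) (hp : 0 < p.natDegree) :
    N.comp p ≠ 0 := by
  rw [Ne, Polynomial.comp_eq_zero_iff]
  rintro (h | ⟨-, h⟩)
  · exact hN h
  · rw [h, Polynomial.natDegree_C] at hp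
    exact lt_irrefl _ hp

theorem qtyT_nonneg (q : ℕ) (a : ℕ → K) (N : Polynomial K) : 0 ≤ qtyT q a N :=
  mul_nonneg (by positivity) (lFracNorm_nonneg _ _)

/-- If the `t`-adic quantity at `N` is less than `q ^ (-l + 1)` and positive, then substituting `p`
into `N` bounds the `p`-adic quantity by `q ^ (-l m)`. -/
theorem qtyP_comp_le {q : ℕ} (hq : 1 < q) (a : ℕ → K) {p : Polynomial K} (hp : 0 < p.natDegree)
    {N : Polynomial K} (hN : N ≠ 0) (l : ℕ) (hpos : 0 < qtyT q a N)
    (hlt : qtyT q a N < (q : ℝ) ^ (-(l : ℤ) + 1)) :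
    qtyP q a p (N.comp p) ≤ (q : ℝ) ^ (-((l * p.natDegree : ℕ) : ℤ)) := by
  have hq1 : (1 : ℝ) < q := by exact_mod_cast hq
  have hq0 : (q : ℝ) ≠ 0 := by positivity
  obtain ⟨G, b, h1, h2⟩ := exists_polyToL_mul_theta_eq hp N a
  rcases forall_eq_zero_or_exists_isLeadIndex b with hb | ⟨i, hi⟩
  · rw [qtyT, h1, lFracNorm_polyToL_add_theta_eq_zero q G hb, mul_zero] at hpos
    exact absurd hpos (lt_irrefl _)
  rw [qtyT, h1, hi.lFracNorm_polyToL_add_theta, ← zpow_add₀ hq0, ← zpow_add₀ hq0,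
    zpow_lt_zpow_iff_right₀ hq1] at hlt
  have hfin : FiniteMultiplicity p (N.comp p) :=
    FiniteMultiplicity.of_not_isUnit (fun hu => hp.ne' (Polynomial.natDegree_eq_zero_of_isUnit hu))
      (comp_ne_zero_of_natDegree_pos hN hp)
  have hdvd : p ^ N.natTrailingDegree ∣ N.comp p := by
    obtain ⟨N', hN'⟩ := Polynomial.X_pow_dvd_iff.2 fun d hd =>
      Polynomial.coeff_eq_zero_of_lt_natTrailingDegree (p := N) hd
    refine ⟨N'.comp p, ?_⟩
    conv_lhs => rw [hN']
    simp
  have hmult := hfin.le_multiplicity_of_pow_dvd hdvd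
  rw [qtyP, h2, hi.lFracNorm_polyToL_add_thetaSubst q _ hp, ← zpow_mul, ← zpow_add₀ hq0,
    ← zpow_add₀ hq0, zpow_le_zpow_iff_right₀ hq1, Polynomial.natDegree_comp]
  push_cast
  have hm : (0 : ℤ) ≤ p.natDegree := by positivity
  have hmult' : (N.natTrailingDegree : ℤ) ≤ multiplicity p (N.comp p) := by exact_mod_cast hmult
  have hlt' : (N.natDegree : ℤ) - multiplicity p (N.comp p) - i ≤ -l := by omega
  nlinarith

theorem le_qtyP {q : ℕ} (hq : 1 < q) (a : ℕ → K) {p : Polynomial K} (hp : 0 < p.natDegree)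
    (l : ℕ) (hT : ∀ N : Polynomial K, N ≠ 0 → (q : ℝ) ^ (-(l : ℤ)) ≤ qtyT q a N)
    {N : Polynomial K} (hN : N ≠ 0) :
    (q : ℝ) ^ (-((l * p.natDegree : ℕ) : ℤ)) ≤ qtyP q a p N := by
  have hq1 : (1 : ℝ) < q := by exact_mod_cast hq
  have hq0 : (q : ℝ) ≠ 0 := by positivity
  have hp0 : p ≠ 0 := by rintro rfl; simp at hp
  obtain ⟨M, hM⟩ := pow_multiplicity_dvd p N
  set k := multiplicity p N with hk
  have hM0 : M ≠ 0 := by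
    rintro rfl
    exact hN (hM.trans (mul_zero _))
  obtain ⟨c, hc, hcd⟩ := exists_sum_X_pow_mul_comp hp M
  obtain ⟨s₀, hs₀, hcs₀⟩ : ∃ s < p.natDegree, c s ≠ 0 := by
    by_contra! h
    refine hM0 (hc.trans (Finset.sum_eq_zero fun s hs => ?_))
    rw [h s (Finset.mem_range.1 hs), Polynomial.zero_comp, mul_zero]
  choose G b h1 h2 using fun s => exists_polyToL_mul_theta_eq hp (Polynomial.X ^ k * c s) a
  have hXc : Polynomial.X ^ k * c s₀ ≠ 0 := mul_ne_zero (pow_ne_zero _ Polynomial.X_ne_zero) hcs₀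
  have hT₀ := hT _ hXc
  obtain ⟨i₀, hi₀⟩ : ∃ i, IsLeadIndex (b s₀) i := by
    refine (forall_eq_zero_or_exists_isLeadIndex (b s₀)).resolve_left fun hb => ?_
    rw [qtyT, h1, lFracNorm_polyToL_add_theta_eq_zero q _ hb, mul_zero] at hT₀
    exact absurd hT₀ (not_le.2 (by positivity))
  have hdeg : (Polynomial.X ^ k * c s₀).natDegree = k + (c s₀).natDegree := by
    rw [Polynomial.natDegree_mul (pow_ne_zero _ Polynomial.X_ne_zero) hcs₀,
      Polynomial.natDegree_X_pow]
  have htrail : k ≤ (Polynomial.X ^ k * c s₀).natTrailingDegree :=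
    Polynomial.le_natTrailingDegree hXc fun n hn =>
      Polynomial.X_pow_dvd_iff.1 (dvd_mul_right _ _) n hn
  rw [qtyT, h1, hi₀.lFracNorm_polyToL_add_theta, ← zpow_add₀ hq0, ← zpow_add₀ hq0,
    zpow_le_zpow_iff_right₀ hq1, hdeg] at hT₀
  have hmul : polyToL N * thetaSubst a p = ∑ s ∈ Finset.range p.natDegree,
      polyToL (Polynomial.X ^ s) * (polyToL ((G s).comp p) + thetaSubst (b s) p) := by
    have hN' : N = ∑ s ∈ Finset.range p.natDegree,
        Polynomial.X ^ s * (Polynomial.X ^ k * c s).comp p := by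
      rw [hM, hc, Finset.mul_sum]
      refine Finset.sum_congr rfl fun s _ => ?_
      rw [Polynomial.mul_comp, Polynomial.X_pow_comp]
      ring
    simp only [← h2, ← mul_assoc]
    rw [← Finset.sum_mul]
    congr 1
    conv_lhs => rw [hN']
    simp only [polyToL, map_sum, map_mul]
  have hNdeg : N.natDegree = k * p.natDegree + M.natDegree := by
    rw [hM, Polynomial.natDegree_mul (pow_ne_zero _ hp0) hM0, Polynomial.natDegree_pow]
  have hle := hi₀.le_lFracNorm_sum hq.le hp (fun s => (G s).comp p) b hs₀
  rw [← hmul] at hle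
  rw [qtyP]
  refine le_trans ?_ (mul_le_mul_of_nonneg_left hle (by positivity))
  rw [← hk, ← zpow_mul, ← zpow_add₀ hq0, ← zpow_add₀ hq0, zpow_le_zpow_iff_right₀ hq1, hNdeg]
  have hcd' : (p.natDegree : ℤ) * (c s₀).natDegree ≤ M.natDegree := by exact_mod_cast hcd s₀
  have hm : (0 : ℤ) ≤ p.natDegree := by positivity
  have hdc : -(l : ℤ) ≤ (c s₀).natDegree - i₀ := by omega
  push_cast
  nlinarith

/-- **(Robertson.)**  If `Θ(t) = Σ a_i t^{-i}` satisfies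
`inf |N|·|N|_t·⟨N·Θ(t)⟩ = q^{-l}` with `l ≥ 1`, then for any irreducible
`p(t)` of degree `m`, the series `Θ(p(t)) = Σ a_i p(t)^{-i}` satisfies
`inf |N|·|N|_{p(t)}·⟨N·Θ(p(t))⟩ = q^{-lm}`. -/
theorem counterexample_transference {K : Type*} [Field K] [Fintype K]
    (a : ℕ → K) (p : Polynomial K) (hp : Irreducible p) (m : ℕ)
    (hm : m = p.natDegree) (l : ℕ) (hl : 0 < l)
    (h : sInf {x : ℝ | ∃ N : Polynomial K, N ≠ 0 ∧ x = qtyT (Fintype.card K) a N}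
      = (Fintype.card K : ℝ) ^ (-(l : ℤ))) :
    sInf {x : ℝ | ∃ N : Polynomial K, N ≠ 0 ∧ x = qtyP (Fintype.card K) a p N}
      = (Fintype.card K : ℝ) ^ (-((l * m : ℕ) : ℤ)) := by
  subst hm
  have hp1 : 0 < p.natDegree := hp.natDegree_pos
  have hq : 1 < Fintype.card K := Fintype.one_lt_card
  have hq1 : (1 : ℝ) < Fintype.card K := by exact_mod_cast hq
  have hT : ∀ N : Polynomial K, N ≠ 0 →
      (Fintype.card K : ℝ) ^ (-(l : ℤ)) ≤ qtyT (Fintype.card K) a N := fun N hN => by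
    rw [← h]
    exact csInf_le ⟨0, by rintro _ ⟨N, -, rfl⟩; exact qtyT_nonneg _ _ _⟩ ⟨N, hN, rfl⟩
  have hP : ∀ x ∈ {x : ℝ | ∃ N : Polynomial K, N ≠ 0 ∧ x = qtyP (Fintype.card K) a p N},
      (Fintype.card K : ℝ) ^ (-((l * p.natDegree : ℕ) : ℤ)) ≤ x := by
    rintro _ ⟨N, hN, rfl⟩
    exact le_qtyP hq a hp1 l hT hN
  obtain ⟨_, ⟨N, hN, rfl⟩, hlt⟩ := exists_lt_of_csInf_lt
    (s := {x : ℝ | ∃ N : Polynomial K, N ≠ 0 ∧ x = qtyT (Fintype.card K) a N})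
    (b := (Fintype.card K : ℝ) ^ (-(l : ℤ) + 1)) ⟨_, 1, one_ne_zero, rfl⟩
    (by rw [h]; exact zpow_lt_zpow_right₀ hq1 (by omega))
  have hcomp : N.comp p ≠ 0 := comp_ne_zero_of_natDegree_pos hN hp1
  refine le_antisymm ((csInf_le ⟨_, hP⟩ ⟨_, hcomp, rfl⟩).trans
    (qtyP_comp_le hq a hp1 hN l ((by positivity : (0 : ℝ) < _).trans_le (hT N hN)) hlt))
    (le_csInf ⟨_, _, hcomp, rfl⟩ hP)

end
end

section
/- Let W be the number wall of a bi-infinite sequence over a field containing a window of side length l with inner frame geometric sequences A_k, B_k, C_k, D_k (ratios P, Q, R, S) and outer frame entries E_k, F_k, G_k, H_k (top, left, right, bottom). Then for 0 ≤ k ≤ l+1 the bottom outer-frame entries satisfy H_k = D_k·(Q·E_k/A_k + (−1)^k·P·F_k/B_k − (−1)^k·S·G_k/C_k)/R. -/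
/-- The number wall of a doubly infinite sequence `s` over a field:
`W_{m,n} = det (s_{i-j+n})_{0 ≤ i,j ≤ m}` for `m ≥ 0`, with `W_{-1,n} = 1`
and `W_{m,n} = 0` for `m < -1`. -/
noncomputable def numberWall {K : Type*} [Field K] (s : ℤ → K) (m n : ℤ) : K :=
  if m < -1 then 0
  else if m = -1 then 1
  else Matrix.det (Matrix.of fun i j : Fin (m.toNat + 1) => s ((i : ℤ) - (j : ℤ) + n))


section Toeplitz

variable {K : Type*} [Field K]

/-- The `N × N` Toeplitz determinant `det (s (i - j + n))`. -/
noncomputable def toeplitzDet (s : ℤ → K) (N : ℕ) (n : ℤ) : K :=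
  Matrix.det (Matrix.of fun i j : Fin N => s ((i : ℤ) - (j : ℤ) + n))

theorem numberWall_eq_toeplitzDet (s : ℤ → K) (N : ℕ) (m n : ℤ) (hm : m = N - 1) :
    numberWall s m n = toeplitzDet s N n := by
  subst hm
  rcases N with _ | N
  · simp [numberWall, toeplitzDet]
  · have h : ((N + 1 : ℕ) - 1 : ℤ).toNat = N := by omega
    have h1 : ¬ ((N + 1 : ℕ) - 1 : ℤ) < -1 := by omega
    have h2 : ¬ ((N + 1 : ℕ) - 1 : ℤ) = -1 := by omega
    rw [numberWall, if_neg h1, if_neg h2, h, toeplitzDet]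

/-- The convolution of `p`, restricted to the finite set `I`, with `s`. -/
def conv (I : Finset ℤ) (p s : ℤ → K) (q : ℤ) : K := ∑ j ∈ I, p j * s (q - j)

/-- `p` vanishes outside the interval `[a, b]`, which is contained in `I`. -/
def SupportedOn (I : Finset ℤ) (a b : ℤ) (p : ℤ → K) : Prop :=
  (∀ j, a ≤ j → j ≤ b → j ∈ I) ∧ ∀ j, j < a ∨ b < j → p j = 0

variable {I : Finset ℤ}

theorem conv_comm (f p s : ℤ → K) (q : ℤ) :
    conv I f (conv I p s) q = conv I p (conv I f s) q := by
  simp only [conv, Finset.mul_sum]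
  rw [Finset.sum_comm]
  refine Finset.sum_congr rfl fun i _ => Finset.sum_congr rfl fun j _ => ?_
  rw [sub_right_comm]
  ring

theorem conv_add_left (p p' s : ℤ → K) (q : ℤ) :
    conv I (fun j => p j + p' j) s q = conv I p s q + conv I p' s q := by
  simp [conv, add_mul, Finset.sum_add_distrib]

theorem conv_mul_left (c : K) (p s : ℤ → K) (q : ℤ) :
    conv I (fun j => c * p j) s q = c * conv I p s q := by
  simp [conv, Finset.mul_sum, mul_assoc]

theorem SupportedOn.conv_eq_sum {a : ℤ} {N : ℕ} {p : ℤ → K}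
    (hp : SupportedOn I a (a + N) p) (s : ℤ → K) (q : ℤ) :
    conv I p s q = ∑ j : Fin (N + 1), p (a + (j : ℕ)) * s (q - (a + (j : ℕ))) := by
  rw [Fin.sum_univ_eq_sum_range (fun j : ℕ => p (a + j) * s (q - (a + j))) (N + 1)]
  have hinj : Set.InjOn (fun j : ℕ => a + (j : ℤ)) (Finset.range (N + 1)) := by
    intro i _ j _ h
    simpa using h
  rw [← Finset.sum_image (f := fun j : ℤ => p j * s (q - j)) hinj, conv]
  symm
  refine Finset.sum_subset ?_ ?_
  · intro j hj
    simp only [Finset.mem_image, Finset.mem_range] at hj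
    obtain ⟨i, hi, rfl⟩ := hj
    exact hp.1 _ (by omega) (by omega)
  · intro j _ hj
    rw [hp.2 j, zero_mul]
    by_contra hcon
    apply hj
    simp only [Finset.mem_image, Finset.mem_range]
    exact ⟨(j - a).toNat, by omega, by omega⟩

/-- If `t` vanishes strictly between `lo` and `hi`, at most two terms of `conv I p t q` survive. -/
theorem SupportedOn.conv_eq_of_gap {a b lo hi : ℤ} {p t : ℤ → K} (hp : SupportedOn I a b p)
    (ht : ∀ q, lo < q → q < hi → t q = 0) (hlh : lo < hi) (q : ℤ) (hlo : lo ≤ q - b)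
    (hhi : q - a ≤ hi) :
    conv I p t q = p (q - hi) * t hi + p (q - lo) * t lo := by
  have h1 : ∀ j ∈ I, p j * t (q - j) =
      (if q - hi = j then p j * t (q - j) else 0) + if q - lo = j then p j * t (q - j) else 0 := by
    intro j _
    by_cases h2 : q - hi = j
    · rw [if_pos h2, if_neg (by omega), add_zero]
    by_cases h3 : q - lo = j
    · rw [if_neg h2, if_pos h3, zero_add]
    rw [if_neg h2, if_neg h3, add_zero]
    by_cases h4 : j < a ∨ b < j
    · rw [hp.2 j h4, zero_mul]
    · rw [ht (q - j) (by omega) (by omega), mul_zero]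
  rw [conv, Finset.sum_congr rfl h1, Finset.sum_add_distrib, Finset.sum_ite_eq, Finset.sum_ite_eq]
  have h5 : ∀ j, j ∉ I → p j = 0 := fun j hj => hp.2 j (by
    by_contra hcon
    exact hj (hp.1 j (by omega) (by omega)))
  congr 1
  · split_ifs with h
    · rw [sub_sub_cancel]
    · rw [h5 _ h, zero_mul]
  · split_ifs with h
    · rw [sub_sub_cancel]
    · rw [h5 _ h, zero_mul]

/-- If `u` vanishes strictly between `q - d` and `q`, only the extreme terms survive. -/
theorem SupportedOn.conv_eq_of_zero {d : ℕ} (hd : 0 < d) {f u : ℤ → K}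
    (hf : SupportedOn I 0 d f) (q : ℤ) (hu : ∀ r, q - d < r → r < q → u r = 0) :
    conv I f u q = f 0 * u q + f d * u (q - d) := by
  rw [hf.conv_eq_of_gap (lo := q - d) (hi := q) hu (by omega) q (by omega) (by omega), sub_self,
    sub_sub_cancel]

theorem det_mul_apply_of_mulVec_eq_single {n : ℕ} (M : Matrix (Fin (n + 1)) (Fin (n + 1)) K)
    (v : Fin (n + 1) → K) (i j : Fin (n + 1)) (r : K) (h : M.mulVec v = Pi.single i r) :
    M.det * v j = r * ((-1) ^ (i + j : ℕ) * (M.submatrix i.succAbove j.succAbove).det) := by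
  have h1 := congrArg (fun w => M.adjugate.mulVec w j) h
  simp only [Matrix.mulVec_mulVec, Matrix.adjugate_mul, Matrix.smul_mulVec, Matrix.one_mulVec,
    Pi.smul_apply, smul_eq_mul, Matrix.mulVec_single] at h1
  rw [h1]
  simp [Matrix.col, Matrix.adjugate_fin_succ_eq_det_submatrix]
  ring

/-- Solvability of a Toeplitz system with nonzero determinant. -/
theorem exists_conv_eq (s r : ℤ → K) (N : ℕ) (a c : ℤ) (hI : ∀ j, a ≤ j → j < a + N → j ∈ I)
    (h : toeplitzDet s N (c - a) ≠ 0) :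
    ∃ p : ℤ → K, SupportedOn I a (a + N - 1) p ∧ ∀ q, c ≤ q → q < c + N → conv I p s q = r q := by
  rcases N with _ | N
  · exact ⟨fun _ => 0, ⟨fun j h1 h2 => by push_cast at h2; omega, fun _ _ => rfl⟩,
      fun q h1 h2 => by push_cast at h2; omega⟩
  set M : Matrix (Fin (N + 1)) (Fin (N + 1)) K :=
    Matrix.of fun i j : Fin (N + 1) => s ((i : ℤ) - (j : ℤ) + (c - a)) with hM
  have hdet : IsUnit M.det := isUnit_iff_ne_zero.2 h
  set v := M⁻¹.mulVec (fun i : Fin (N + 1) => r (c + (i : ℕ))) with hv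
  have hMv : M.mulVec v = fun i : Fin (N + 1) => r (c + (i : ℕ)) := by
    rw [hv, Matrix.mulVec_mulVec, Matrix.mul_nonsing_inv _ hdet, Matrix.one_mulVec]
  let p : ℤ → K := fun j => if hj : a ≤ j ∧ j ≤ a + N then v ⟨(j - a).toNat, by omega⟩ else 0
  have hp : SupportedOn I a (a + N) p :=
    ⟨fun j h1 h2 => hI j h1 (by push_cast; omega), fun j hj => dif_neg (by omega)⟩
  refine ⟨p, by convert hp using 1; push_cast; ring, fun q h1 h2 => ?_⟩
  have h3 := congrFun hMv ⟨(q - c).toNat, by omega⟩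
  rw [hp.conv_eq_sum]
  have hq : c + (((q - c).toNat : ℕ) : ℤ) = q := by omega
  simp only [hq] at h3
  rw [← h3, Matrix.mulVec, dotProduct]
  refine Finset.sum_congr rfl fun j _ => ?_
  have hpj : p (a + (j : ℕ)) = v j := by
    have : a ≤ a + ((j : ℕ) : ℤ) ∧ a + ((j : ℕ) : ℤ) ≤ a + N := by omega
    simp only [p, dif_pos this]
    congr 1
    ext
    simp
  rw [hpj, mul_comm, hM, Matrix.of_apply]
  congr 2
  simp only
  omega

theorem SupportedOn.toeplitzDet_mul_top {s p : ℤ → K} {N : ℕ} {a c : ℤ} {ρ : K}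
    (hp : SupportedOn I a (a + N) p) (h0 : ∀ q, c ≤ q → q < c + N → conv I p s q = 0)
    (h1 : conv I p s (c + N) = ρ) :
    toeplitzDet s (N + 1) (c - a) * p (a + N) = ρ * toeplitzDet s N (c - a) := by
  have := det_mul_apply_of_mulVec_eq_single
    (Matrix.of fun i j : Fin (N + 1) => s ((i : ℤ) - (j : ℤ) + (c - a)))
    (fun j => p (a + (j : ℕ))) (Fin.last N) (Fin.last N) ρ ?_
  · rw [toeplitzDet, toeplitzDet]
    simp only [Fin.val_last] at this
    rw [this, ← two_mul, pow_mul, neg_one_sq, one_pow, one_mul]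
    congr 2
    ext i j
    simp
  · ext i
    have h2 : (Matrix.of fun i j : Fin (N + 1) => s ((i : ℤ) - (j : ℤ) + (c - a))).mulVec
        (fun j => p (a + (j : ℕ))) i = conv I p s (c + (i : ℕ)) := by
      rw [hp.conv_eq_sum, Matrix.mulVec, dotProduct]
      refine Finset.sum_congr rfl fun j _ => ?_
      rw [mul_comm, Matrix.of_apply]
      congr 2
      omega
    rw [h2]
    rcases eq_or_ne i (Fin.last N) with rfl | hi
    · simp [h1]
    · rw [Pi.single_eq_of_ne hi, h0 _ (by omega)]
      have := Fin.val_lt_last hi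
      omega

theorem SupportedOn.toeplitzDet_mul_bot {s p : ℤ → K} {N : ℕ} {a c : ℤ} {ρ : K}
    (hp : SupportedOn I a (a + N) p) (h0 : ∀ q, c < q → q ≤ c + N → conv I p s q = 0)
    (h1 : conv I p s c = ρ) :
    toeplitzDet s (N + 1) (c - a) * p a = ρ * toeplitzDet s N (c - a) := by
  have := det_mul_apply_of_mulVec_eq_single
    (Matrix.of fun i j : Fin (N + 1) => s ((i : ℤ) - (j : ℤ) + (c - a)))
    (fun j => p (a + (j : ℕ))) 0 0 ρ ?_
  · rw [toeplitzDet, toeplitzDet]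
    simp only [Fin.val_zero, Nat.cast_zero, add_zero, pow_zero, one_mul] at this
    rw [this]
    congr 2
    ext i j
    simp
  · ext i
    have h2 : (Matrix.of fun i j : Fin (N + 1) => s ((i : ℤ) - (j : ℤ) + (c - a))).mulVec
        (fun j => p (a + (j : ℕ))) i = conv I p s (c + (i : ℕ)) := by
      rw [hp.conv_eq_sum, Matrix.mulVec, dotProduct]
      refine Finset.sum_congr rfl fun j _ => ?_
      rw [mul_comm, Matrix.of_apply]
      congr 2
      omega
    rw [h2]
    rcases eq_or_ne i 0 with rfl | hi
    · simp [h1]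
    · rw [Pi.single_eq_of_ne hi, h0 _ _ (by omega)]
      have := Fin.pos_iff_ne_zero.2 hi
      rw [Fin.lt_def, Fin.val_zero] at this
      omega

theorem SupportedOn.toeplitzDet_mul_of_conv_eq_zero {s p : ℤ → K} {N : ℕ} {a c : ℤ}
    (hp : SupportedOn I a (a + N) p) (h0 : ∀ q, c ≤ q → q < c + N → conv I p s q = 0) :
    toeplitzDet s N (c - a) * p a = (-1) ^ N * p (a + N) * toeplitzDet s N (c - a - 1) := by
  let M : Matrix (Fin (N + 1)) (Fin (N + 1)) K := Matrix.of fun i j =>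
    Fin.lastCases (if j = 0 then 1 else 0) (fun i' : Fin N => s ((i' : ℤ) - (j : ℤ) + (c - a))) i
  have h1 := det_mul_apply_of_mulVec_eq_single M
    (fun j => p (a + (j : ℕ))) (Fin.last N) (Fin.last N) (p a) ?_
  · have h2 : M.det = (-1) ^ N * toeplitzDet s N (c - a - 1) := by
      rw [Matrix.det_succ_row M (Fin.last N), Finset.sum_eq_single 0]
      · simp only [M, Matrix.of_apply, Fin.lastCases_last, if_true, Fin.val_last, Fin.val_zero,
          add_zero, mul_one, toeplitzDet]
        congr 2
        ext i j
        simp only [Matrix.submatrix_apply, Matrix.of_apply, Fin.succAbove_last,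
          Fin.lastCases_castSucc, Fin.zero_succAbove, Fin.val_succ]
        congr 1
        push_cast
        ring
      · intro j _ hj
        simp [M, hj]
      · simp
    have h3 : (M.submatrix (Fin.last N).succAbove (Fin.last N).succAbove).det =
        toeplitzDet s N (c - a) := by
      rw [toeplitzDet]
      congr 1
      ext i j
      simp [M]
    rw [h2, h3] at h1
    simp only [Fin.val_last] at h1
    rw [← two_mul, pow_mul, neg_one_sq, one_pow, one_mul] at h1
    linear_combination -h1
  · ext i
    refine Fin.lastCases ?_ (fun i' => ?_) i
    · simp [Matrix.mulVec, dotProduct, M]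
    · rw [Pi.single_eq_of_ne (Fin.castSucc_lt_last i').ne,
        ← h0 (c + (i' : ℕ)) (by omega) (by omega), hp.conv_eq_sum, Matrix.mulVec, dotProduct]
      refine Finset.sum_congr rfl fun j _ => ?_
      simp only [M, Matrix.of_apply, Fin.lastCases_castSucc]
      rw [mul_comm]
      congr 2
      omega

theorem exists_bot_one (s : ℤ → K) (N : ℕ) (a c : ℤ) (hI : ∀ j, a ≤ j → j ≤ a + N → j ∈ I)
    (h : toeplitzDet s N (c - a - 1) ≠ 0) :
    ∃ p : ℤ → K, SupportedOn I a (a + N) p ∧ p a = 1 ∧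
      ∀ q, c ≤ q → q < c + N → conv I p s q = 0 := by
  obtain ⟨p, hp, hps⟩ := exists_conv_eq (I := I) s (fun q => -s (q - a)) N (a + 1) c
    (fun j h1 h2 => hI j (by omega) (by omega)) (by rwa [← sub_sub])
  refine ⟨fun j => (if j = a then 1 else 0) + p j, ⟨hI, fun j hj => ?_⟩, ?_, fun q h1 h2 => ?_⟩
  · simp only
    rw [if_neg (by omega), hp.2 j (by omega), add_zero]
  · simp [hp.2 a (by omega)]
  · rw [conv_add_left, hps q h1 h2, conv]
    simp [hI a (by omega) (by omega)]

theorem exists_top_one (s : ℤ → K) (N : ℕ) (a c : ℤ) (hI : ∀ j, a ≤ j → j ≤ a + N → j ∈ I)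
    (h : toeplitzDet s N (c - a) ≠ 0) :
    ∃ p : ℤ → K, SupportedOn I a (a + N) p ∧ p (a + N) = 1 ∧
      ∀ q, c ≤ q → q < c + N → conv I p s q = 0 := by
  obtain ⟨p, hp, hps⟩ := exists_conv_eq (I := I) s (fun q => -s (q - (a + N))) N a c
    (fun j h1 h2 => hI j (by omega) (by omega)) h
  refine ⟨fun j => (if j = a + N then 1 else 0) + p j, ⟨hI, fun j hj => ?_⟩, ?_,
    fun q h1 h2 => ?_⟩
  · simp only
    rw [if_neg (by omega), hp.2 j (by omega), add_zero]
  · simp [hp.2 (a + N) (by omega)]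
  · rw [conv_add_left, hps q h1 h2, conv]
    simp [hI (a + N) (by omega) (by omega)]

theorem conv_eq_zero_backward {d l k : ℕ} (hd : 0 < d) {n : ℤ}
    {s f g : ℤ → K} (hf : SupportedOn I 0 d f) (hf0 : f 0 = 1) (hfd : f d ≠ 0)
    (hgap : ∀ q, n - 1 < q → q < n + l + d → conv I f s q = 0)
    (hg : SupportedOn I (k - 1 - l) d g)
    (hg0 : g (k - 1 - l) * conv I f s (n + l + d) = 1)
    (hu0 : ∀ q, n + k ≤ q → q ≤ n + k + d - 2 → conv I g s q = 0)
    (hu1 : conv I g s (n + k + d - 1) = 1) :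
    (∀ q, n ≤ q → q ≤ n + k + d - 2 → conv I g s q = 0) ∧
      f d * conv I g s (n - 1) = g d * conv I f s (n - 1) := by
  have step : ∀ q, n - 1 ≤ q → q ≤ n + k - 1 →
      (∀ r, q < r → r ≤ n + k + d - 2 → conv I g s r = 0) →
      f d * conv I g s q = g (q + d - (n - 1)) * conv I f s (n - 1) := by
    intro q h1 h2 h3
    have h4 := hf.conv_eq_of_zero (u := conv I g s) hd (q + d)
      (fun r hr hr' => h3 r (by omega) (by omega))
    rw [conv_comm, hg.conv_eq_of_gap hgap (by omega) (q + d) (by omega) (by omega), hf0, one_mul,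
      add_sub_cancel_right] at h4
    rcases h2.eq_or_lt with rfl | h5
    · have e1 : n + k - 1 + d - (n + l + d) = (k - 1 - l : ℤ) := by ring
      have e2 : n + k - 1 + d = n + k + d - 1 := by ring
      rw [e1, hg0, e2, hu1] at h4
      rw [e2]
      linear_combination -h4
    · rw [hg.2 (q + d - (n + l + d)) (by omega), h3 (q + d) (by omega) (by omega)] at h4
      linear_combination -h4
  have main : ∀ i : ℕ, ∀ q, n ≤ q → n + k - i ≤ q → q ≤ n + k + d - 2 → conv I g s q = 0 := by
    intro i
    induction i with
    | zero => exact fun q _ h2 h3 => hu0 q (by omega) h3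
    | succ i ih =>
      intro q h1 h2 h3
      by_cases h4 : n + k - i ≤ q
      · exact ih q h1 h4 h3
      · have h5 := step q (by omega) (by omega)
          (fun r hr hr' => ih r (by omega) (by push_cast at h2; omega) hr')
        rw [hg.2 (q + d - (n - 1)) (by omega), zero_mul] at h5
        exact (mul_eq_zero.1 h5).resolve_left hfd
  have hz : ∀ q, n ≤ q → q ≤ n + k + d - 2 → conv I g s q = 0 :=
    fun q h1 h2 => main k q h1 (by omega) h2
  refine ⟨hz, ?_⟩
  have h := step (n - 1) le_rfl (by omega) (fun r hr hr' => hz r (by omega) hr')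
  rwa [add_sub_cancel_left] at h

theorem conv_add_conv_eq_forward {d l k : ℕ} (hd : 0 < d) (hk : k ≤ l + 1) {n : ℤ} {β : K}
    {s f x e : ℤ → K} (hf : SupportedOn I 0 d f) (hf0 : f 0 = 1)
    (hgap : ∀ q, n - 1 < q → q < n + l + d → conv I f s q = 0)
    (hx : SupportedOn I 0 (d + k) x) (he : SupportedOn I 1 d e)
    (hβ : β * x (d + k) * conv I f s (n - 1) = -1)
    (hx0 : ∀ q, n - 1 ≤ q → q ≤ n + d + k - 2 → conv I x s q = 0)
    (he0 : ∀ q, n + k ≤ q → q ≤ n + k + d - 2 → conv I e s q = 0)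
    (he1 : conv I e s (n + k + d - 1) = 1) (q : ℤ) (hq : n + k ≤ q) (hq' : q ≤ n + l + d) :
    β * conv I x s q + conv I e s q = β * x (q - (n + l + d)) * conv I f s (n + l + d) := by
  have main : ∀ i : ℕ, ∀ q, n + k ≤ q → q ≤ n + l + d → q ≤ n + k + d - 2 + i →
      β * conv I x s q + conv I e s q = β * x (q - (n + l + d)) * conv I f s (n + l + d) := by
    intro i
    induction i with
    | zero =>
      intro q h1 h2 h3
      rw [hx0 q (by omega) (by omega), he0 q h1 (by omega), hx.2 _ (by omega)]
      simp
    | succ i ih =>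
      intro q h1 h2 h3
      push_cast at h3
      by_cases h4 : q ≤ n + k + d - 2 + i
      · exact ih q h1 h2 h4
      by_cases h5 : q = n + k + d - 1
      · subst h5
        have h6 := hf.conv_eq_of_zero (u := conv I x s) hd (n + k + d - 1)
          (fun r hr hr' => hx0 r (by omega) (by omega))
        rw [conv_comm, hx.conv_eq_of_gap hgap (by omega) _ (by omega) (by omega), hf0, one_mul,
          hx0 (n + k + d - 1 - d) (by omega) (by omega)] at h6
        have e1 : n + k + d - 1 - (n - 1) = (d + k : ℤ) := by ring
        rw [e1] at h6
        rw [he1]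
        linear_combination hβ - β * h6
      · have hg : SupportedOn I 0 (d + k) (fun j => β * x j + e j) :=
          ⟨hx.1, fun j hj => by simp only; rw [hx.2 j hj, he.2 j (by omega)]; simp⟩
        have hu : ∀ r, conv I (fun j => β * x j + e j) s r = β * conv I x s r + conv I e s r := by
          intro r
          rw [conv_add_left, conv_mul_left]
        have hz : ∀ r, q - d ≤ r → r < q → conv I (fun j => β * x j + e j) s r = 0 := by
          intro r hr hr'
          rw [hu, ih r (by omega) (by omega) (by omega), hx.2 _ (by omega)]
          simp
        have h6 := hf.conv_eq_of_zero (u := conv I (fun j => β * x j + e j) s) hd q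
          (fun r hr hr' => hz r hr.le hr')
        rw [conv_comm, hg.conv_eq_of_gap hgap (by omega) _ (by omega) (by omega), hf0, one_mul,
          hz (q - d) le_rfl (by omega), hu, hx.2 (q - (n - 1)) (by omega),
          he.2 (q - (n - 1)) (by omega), he.2 (q - (n + l + d)) (by omega)] at h6
        linear_combination -h6
  exact main (q - n + 1).toNat q hq hq' (by omega)

theorem toeplitzDet_outer_bottom_of_conv {d l k : ℕ} {n : ℤ} {β ρ : K}
    {s w : ℤ → K} (hw : SupportedOn I (k - 1 - l) (d + k) w) (hwt : w (d + k) = β) (hβ : β ≠ 0)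
    (h0 : ∀ q, n - 1 ≤ q → q < n + l + d → conv I w s q = 0)
    (h1 : conv I w s (n + l + d) = ρ) :
    toeplitzDet s (d + l + 2) (n + l - k) = ρ / β * toeplitzDet s (d + l + 1) (n + l - k) := by
  have e1 : ((k - 1 - l : ℤ) + (d + l + 1 : ℕ)) = d + k := by push_cast; ring
  have e2 : (n - 1 + (d + l + 1 : ℕ) : ℤ) = n + l + d := by push_cast; ring
  have e3 : n - 1 - (k - 1 - l) = n + l - k := by ring
  have h := SupportedOn.toeplitzDet_mul_top (s := s) (N := d + l + 1) (c := n - 1) (ρ := ρ)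
    (by rwa [e1]) (fun q hq hq' => h0 q hq (by omega)) (by rwa [e2])
  rw [e1, e3, hwt] at h
  field_simp
  exact h

theorem conv_sub_conv_eq_of_gap {l k : ℕ} (hk : k ≤ l + 1) {n : ℤ} {s x y : ℤ → K}
    (hgap : ∀ q, n - 1 < q → q < n + l → s q = 0) (hlo : s (n - 1) ≠ 0) (hhi : s (n + l) ≠ 0)
    (hx : SupportedOn I 0 k x) (hxt : x k = 1)
    (hx0 : ∀ q, n - 1 ≤ q → q ≤ n + k - 2 → conv I x s q = 0)
    (hy : SupportedOn I (k - 1 - l) 0 y) (hyb : y (k - 1 - l) = 1)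
    (hy0 : ∀ q, n + k ≤ q → q ≤ n + l → conv I y s q = 0)
    (q : ℤ) (hq : n - 1 ≤ q) (hq' : q ≤ n + l) :
    (s (n + l))⁻¹ * conv I y s q - (s (n - 1))⁻¹ * conv I x s q =
      (s (n + l))⁻¹ * y (q - (n - 1)) * s (n - 1) -
        (s (n - 1))⁻¹ * x (q - (n + l)) * s (n + l) := by
  rcases lt_trichotomy q (n + k - 1) with h | rfl | h
  · rw [hx0 q hq (by omega), hy.conv_eq_of_gap hgap (by omega) q (by omega) (by omega),
      hy.2 (q - (n + l)) (by omega), hx.2 (q - (n + l)) (by omega)]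
    ring
  · rw [hx.conv_eq_of_gap hgap (by omega) _ (by omega) (by omega),
      hy.conv_eq_of_gap hgap (by omega) _ (by omega) (by omega)]
    have e1 : n + k - 1 - (n + l) = (k - 1 - l : ℤ) := by ring
    have e2 : n + k - 1 - (n - 1) = (k : ℤ) := by ring
    rw [e1, e2, hyb, hxt]
    field_simp
    ring
  · rw [hy0 q (by omega) hq', hx.conv_eq_of_gap hgap (by omega) q (by omega) (by omega),
      hx.2 (q - (n - 1)) (by omega), hy.2 (q - (n - 1)) (by omega)]
    ring

/-- The bottom outer frame in terms of the recurrence `f` valid across the window and of the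
polynomials `x`, `y` that carry the left and right outer frames. -/
theorem toeplitzDet_outer_bottom {d l k : ℕ} (hk : k ≤ l + 1) {n : ℤ} {s f x y : ℤ → K}
    (hf : SupportedOn I 0 d f) (hf0 : f 0 = 1) (hfd : f d ≠ 0)
    (hgap : ∀ q, n - 1 < q → q < n + l + d → conv I f s q = 0)
    (hlo : conv I f s (n - 1) ≠ 0) (hhi : conv I f s (n + l + d) ≠ 0)
    (hI : ∀ j : ℤ, k - 1 - l ≤ j → j ≤ d + k → j ∈ I)
    (hx : SupportedOn I 0 (d + k) x) (hxt : x (d + k) = 1)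
    (hx0 : ∀ q, n - 1 ≤ q → q ≤ n + d + k - 2 → conv I x s q = 0)
    (hy : SupportedOn I (k - 1 - l) d y) (hyb : y (k - 1 - l) = 1)
    (hy0 : ∀ q, n + k ≤ q → q ≤ n + l + d → conv I y s q = 0)
    (hA : toeplitzDet s d (n - 1 + k) ≠ 0) :
    toeplitzDet s (d + l + 2) (n + l - k) =
      (x 0 * conv I f s (n + l + d) +
        conv I f s (n - 1) * conv I f s (n + l + d) / f d * (y d / conv I f s (n + l + d) +
          numberWall s (d - 2) (n - 1 + k) / toeplitzDet s d (n - 1 + k))) *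
        toeplitzDet s (d + l + 1) (n + l - k) := by
  set lo := conv I f s (n - 1) with hlo'
  set hi := conv I f s (n + l + d) with hhi'
  obtain ⟨e, he, hed, he0, he1⟩ : ∃ e : ℤ → K, SupportedOn I 1 d e ∧
      e d = numberWall s (d - 2) (n - 1 + k) / toeplitzDet s d (n - 1 + k) ∧
      (∀ q, n + k ≤ q → q ≤ n + k + d - 2 → conv I e s q = 0) ∧
      (0 < d → conv I e s (n + k + d - 1) = 1) := by
    rcases d with _ | d
    · refine ⟨fun _ => 0, ⟨fun j h1 h2 => by push_cast at h2; omega, fun _ _ => rfl⟩, ?_, ?_, ?_⟩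
      · simp [numberWall]
      · intro q h1 h2
        simp [conv]
      · intro h
        exact absurd h (lt_irrefl _)
    · have e0 : n + k - 1 = n - 1 + (k : ℤ) := by ring
      obtain ⟨e, he, hes⟩ := exists_conv_eq (I := I) s
        (fun q => if q = n + k + (d + 1 : ℕ) - 1 then 1 else 0) (d + 1) 1 (n + k)
        (fun j h1 h2 => hI j (by omega) (by omega)) (by rwa [e0])
      have he' : SupportedOn I 1 (1 + d) e := by
        convert he using 1
        push_cast
        ring
      have htop := he'.toeplitzDet_mul_top (s := s) (c := n + k) (ρ := 1)
        (fun q h1 h2 => by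
          rw [hes q h1 (by push_cast; omega), if_neg]
          push_cast
          omega)
        (by
          rw [hes _ (by omega) (by push_cast; omega), if_pos]
          push_cast
          ring)
      refine ⟨e, ?_, ?_, ?_, ?_⟩
      · convert he' using 1
        push_cast
        ring
      · rw [numberWall_eq_toeplitzDet s d _ _ (by push_cast; ring), eq_div_iff hA]
        rw [e0, add_comm (1 : ℤ)] at htop
        push_cast
        linear_combination htop
      · intro q h1 h2
        rw [hes q h1 (by omega), if_neg (by omega)]
      · intro _
        rw [hes _ (by push_cast; omega) (by omega), if_pos rfl]
  rw [← hed]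
  have hyt : ∀ j : ℤ, (j < k - 1 - l ∨ d < j) → hi⁻¹ * y j + e j = 0 := by
    intro j hj
    rw [hy.2 j hj, he.2 j (by omega)]
    simp
  set δ := -(hi⁻¹ * y d + e d) / f d with hδ
  have hδf : δ * f d = -(hi⁻¹ * y d + e d) := div_mul_cancel₀ _ hfd
  have hconv : ∀ q, conv I (fun j => (hi⁻¹ * y j + e j) + (-lo⁻¹ * x j + δ * f j)) s q =
      (hi⁻¹ * conv I y s q + conv I e s q) + (-lo⁻¹ * conv I x s q + δ * conv I f s q) := by
    intro q
    rw [conv_add_left, conv_add_left, conv_add_left, conv_mul_left, conv_mul_left, conv_mul_left]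
  rw [toeplitzDet_outer_bottom_of_conv (I := I) (n := n) (β := -lo⁻¹)
    (ρ := (-lo⁻¹ * x 0 + δ) * hi) (s := s)
    (w := fun j => (hi⁻¹ * y j + e j) + (-lo⁻¹ * x j + δ * f j))]
  · rw [hδ]
    field_simp
    ring
  · refine ⟨hI, fun j hj => ?_⟩
    simp only
    rw [hyt j (by omega), hx.2 j (by omega), hf.2 j (by omega)]
    simp
  · rw [hxt]
    rcases Nat.eq_zero_or_pos k with rfl | hk0
    · simp only [Nat.cast_zero, add_zero]
      linear_combination hδf
    · rw [hyt _ (by omega), hf.2 _ (by omega)]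
      simp
  · exact neg_ne_zero.2 (inv_ne_zero hlo)
  all_goals
    rcases Nat.eq_zero_or_pos d with rfl | hd
  · have hs : ∀ q, conv I f s q = s q := by
      intro q
      rw [SupportedOn.conv_eq_sum (N := 0) (by simpa using hf)]
      simp [hf0]
    have hez : ∀ q, conv I e s q = 0 := fun q =>
      Finset.sum_eq_zero fun j _ => by rw [he.2 j (by omega), zero_mul]
    have hcomb := conv_sub_conv_eq_of_gap (I := I) (s := s) (x := x) (y := y) (n := n) hk
      (fun q h1 h2 => by rw [← hs]; exact hgap q h1 (by simpa using h2)) (by rwa [← hs])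
      (fun h0 => hhi (by rw [hhi', hs]; simpa using h0)) (by simpa using hx) (by simpa using hxt)
      (by simpa using hx0) hy hyb (by simpa using hy0)
    simp only [hs, Nat.cast_zero, add_zero, zero_add] at hconv hgap hlo' hhi' hf0 hfd hx hx0 hy hδf hcomb ⊢
    intro q h1 h2
    have h3 := hcomb q h1 h2.le
    have he00 := he.2 0 (by omega)
    rw [hf0, he00] at hδf
    rw [hconv, hez, hhi', hlo']
    rw [hhi'] at hδf
    rcases h1.eq_or_lt with rfl | h1
    · rw [hx.2 (n - 1 - (n + l)) (by omega), sub_self] at h3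
      linear_combination h3 + s (n - 1) * hδf
    · rw [hx.2 (q - (n + l)) (by omega), hy.2 (q - (n - 1)) (by omega)] at h3
      rw [hgap q h1 h2]
      linear_combination h3
  · have hg : SupportedOn I (k - 1 - l) d (fun j => hi⁻¹ * y j + e j) :=
      ⟨fun j h1 h2 => hI j h1 (by omega), hyt⟩
    have hgs : ∀ q, conv I (fun j => hi⁻¹ * y j + e j) s q =
        hi⁻¹ * conv I y s q + conv I e s q := by
      intro q
      rw [conv_add_left, conv_mul_left]
    have hb := conv_eq_zero_backward hd hf hf0 hfd hgap hg
      (by rw [hyb, he.2 _ (by omega), mul_one, add_zero]; exact inv_mul_cancel₀ hhi)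
      (fun q h1 h2 => by rw [hgs, hy0 q h1 (by omega), he0 q h1 h2]; simp)
      (by rw [hgs, hy0 _ (by omega) (by omega), he1 hd]; simp)
    intro q h1 h2
    rw [hconv]
    rcases h1.eq_or_lt with rfl | h1
    · have h3 := hb.2
      rw [hgs] at h3
      rw [hx0 _ le_rfl (by omega)]
      apply mul_left_cancel₀ hfd
      linear_combination h3 + lo * hδf
    rw [hgap q h1 h2]
    by_cases h3 : q ≤ n + k + d - 2
    · rw [← hgs, hb.1 q (by omega) h3, hx0 q (by omega) (by omega)]
      simp
    · have h4 := conv_add_conv_eq_forward (β := -lo⁻¹) hd hk hf hf0 hgap hx he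
        (by rw [hxt, mul_one, neg_mul, inv_mul_cancel₀ hlo]) hx0 he0 (he1 hd) q (by omega) h2.le
      rw [hx.2 (q - (n + l + d)) (by omega)] at h4
      rw [hy0 q (by omega) h2.le]
      linear_combination h4
  · have hs : ∀ q, conv I f s q = s q := by
      intro q
      rw [SupportedOn.conv_eq_sum (N := 0) (by simpa using hf)]
      simp [hf0]
    have hez : ∀ q, conv I e s q = 0 := fun q =>
      Finset.sum_eq_zero fun j _ => by rw [he.2 j (by omega), zero_mul]
    have hcomb := conv_sub_conv_eq_of_gap (I := I) (s := s) (x := x) (y := y) (n := n) hk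
      (fun q h1 h2 => by rw [← hs]; exact hgap q h1 (by simpa using h2)) (by rwa [← hs])
      (fun h0 => hhi (by rw [hhi', hs]; simpa using h0)) (by simpa using hx) (by simpa using hxt)
      (by simpa using hx0) hy hyb (by simpa using hy0)
    simp only [hs, Nat.cast_zero, add_zero, zero_add] at hconv hgap hlo' hhi' hf0 hfd hx hx0 hy hδf hcomb ⊢
    have h3 := hcomb (n + l) (by omega) le_rfl
    rw [hy.2 (n + l - (n - 1)) (by omega), sub_self] at h3
    rw [hconv, hez, hhi', hlo']
    linear_combination h3
  · have h4 := conv_add_conv_eq_forward (β := -lo⁻¹) hd hk hf hf0 hgap hx he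
      (by rw [hxt, mul_one, neg_mul, inv_mul_cancel₀ hlo]) hx0 he0 (he1 hd) (n + l + d)
      (by omega) le_rfl
    rw [sub_self] at h4
    rw [hconv, hy0 _ (by omega) le_rfl]
    linear_combination h4

end Toeplitz

/-- **Outer frame constraint.**  With a window of side `l`, inner frame
entries `A, B, C, D` (top, left, right, bottom) forming geometric progressions
with ratios `P, Q, R, S`, and outer frame entries `E, F, G, H` in corresponding
positions, the bottom outer-frame entries satisfy
`H k = D k·(Q·E k/A k + (-1)^k·P·F k/B k − (-1)^k·S·G k/C k)/R`. -/
theorem numberWall_outer_frame_constraint {K : Type*} [Field K] (s : ℤ → K)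
    (l : ℕ) (hl : 1 ≤ l) (m₀ n₀ : ℤ) (hm₀ : 0 ≤ m₀)
    (A B C D E F G H : ℕ → K) (P Q R S : K)
    (hA : ∀ k : ℕ, A k = numberWall s (m₀ - 1) (n₀ - 1 + k))
    (hB : ∀ k : ℕ, B k = numberWall s (m₀ - 1 + k) (n₀ - 1))
    (hC : ∀ k : ℕ, C k = numberWall s (m₀ + l - k) (n₀ + l))
    (hD : ∀ k : ℕ, D k = numberWall s (m₀ + l) (n₀ + l - k))
    (hE : ∀ k : ℕ, E k = numberWall s (m₀ - 2) (n₀ - 1 + k))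
    (hF : ∀ k : ℕ, F k = numberWall s (m₀ - 1 + k) (n₀ - 2))
    (hG : ∀ k : ℕ, G k = numberWall s (m₀ + l - k) (n₀ + l + 1))
    (hH : ∀ k : ℕ, H k = numberWall s (m₀ + l + 1) (n₀ + l - k))
    (hwindow : ∀ i j : ℕ, i < l → j < l → numberWall s (m₀ + i) (n₀ + j) = 0)
    (hframe : ∀ k : ℕ, k ≤ l + 1 → A k ≠ 0 ∧ B k ≠ 0 ∧ C k ≠ 0 ∧ D k ≠ 0)
    (hP : ∀ k : ℕ, k ≤ l → A (k + 1) = P * A k)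
    (hQ : ∀ k : ℕ, k ≤ l → B (k + 1) = Q * B k)
    (hR : ∀ k : ℕ, k ≤ l → C (k + 1) = R * C k)
    (hS : ∀ k : ℕ, k ≤ l → D (k + 1) = S * D k)
    (hRne : R ≠ 0) :
    ∀ k : ℕ, k ≤ l + 1 →
      H k = D k * (Q * E k / A k + (-1 : K) ^ k * P * F k / B k
        - (-1 : K) ^ k * S * G k / C k) / R := by
  intro k hk
  obtain ⟨d, rfl⟩ : ∃ d : ℕ, m₀ = d := ⟨m₀.toNat, by omega⟩
  have hA' : ∀ i : ℕ, A i = toeplitzDet s d (n₀ - 1 + i) := fun i => by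
    rw [hA, numberWall_eq_toeplitzDet s d _ _ rfl]
  have hB' : ∀ i : ℕ, B i = toeplitzDet s (d + i) (n₀ - 1) := fun i => by
    rw [hB, numberWall_eq_toeplitzDet s (d + i) _ _ (by push_cast; ring)]
  have hD' : ∀ i : ℕ, D i = toeplitzDet s (d + l + 1) (n₀ + l - i) := fun i => by
    rw [hD, numberWall_eq_toeplitzDet s (d + l + 1) _ _ (by push_cast; ring)]
  have hC' : ∀ i M : ℕ, M + i = d + l + 1 → C i = toeplitzDet s M (n₀ + l) := fun i M h => by
    rw [hC, numberWall_eq_toeplitzDet s M _ _ (by omega)]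
  have hF' : F k = toeplitzDet s (d + k) (n₀ - 2) := by
    rw [hF, numberWall_eq_toeplitzDet s (d + k) _ _ (by push_cast; ring)]
  have hG' : ∀ M : ℕ, M + k = d + l + 1 → G k = toeplitzDet s M (n₀ + l + 1) := fun M h => by
    rw [hG, numberWall_eq_toeplitzDet s M _ _ (by omega)]
  have hH' : H k = toeplitzDet s (d + l + 2) (n₀ + l - k) := by
    rw [hH, numberWall_eq_toeplitzDet s (d + l + 2) _ _ (by push_cast; ring)]
  have hA0 : toeplitzDet s d (n₀ - 1) ≠ 0 := by
    have h := (hframe 0 (by omega)).1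
    rw [hA'] at h
    simpa using h
  let I : Finset ℤ := Finset.Icc (-(l + 1)) (d + l + 1)
  have hI : ∀ j : ℤ, -(l + 1) ≤ j → j ≤ d + l + 1 → j ∈ I := fun j h1 h2 =>
    Finset.mem_Icc.2 ⟨h1, h2⟩
  obtain ⟨f, hf, hf0, hfs⟩ := exists_bot_one (I := I) s d 0 n₀
    (fun j h1 h2 => hI j (by omega) (by omega)) (by rwa [sub_zero])
  have hPf : P = (-1) ^ d * f d := by
    have h := hf.toeplitzDet_mul_of_conv_eq_zero hfs
    have h2 := hP 0 (by omega)
    rw [hA', hA'] at h2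
    simp only [sub_zero, zero_add, hf0, Nat.cast_one, Nat.cast_zero, add_zero,
      sub_add_cancel] at h h2
    apply mul_right_cancel₀ hA0
    linear_combination h - h2
  have hfd : f d ≠ 0 := by
    rintro h
    have h2 := hP 0 (by omega)
    rw [hPf, h, mul_zero, zero_mul] at h2
    exact (hframe 1 (by omega)).1 h2
  rw [zero_add] at hf
  have hgap' : ∀ i : ℕ, i ≤ l → ∀ q, n₀ - 1 < q → q < n₀ + i + d → conv I f s q = 0 := by
    intro i
    induction i with
    | zero => exact fun _ q h1 h2 => hfs q (by omega) (by push_cast at h2; omega)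
    | succ i ih =>
      intro hi q h1 h2
      push_cast at h2
      rcases (show q ≤ n₀ + i + d by omega).lt_or_eq with h3 | h3
      · exact ih (by omega) q h1 h3
      · have h4 := SupportedOn.toeplitzDet_mul_top (I := I) (s := s) (p := f) (N := d) (a := 0)
          (c := n₀ + i) (by rwa [zero_add])
          (fun r hr hr' => ih (by omega) r (by omega) hr') rfl
        have h5 := hwindow 0 i (by omega) (by omega)
        rw [numberWall_eq_toeplitzDet s (d + 1) _ _ (by push_cast; ring)] at h5
        rw [sub_zero, h5, zero_mul] at h4
        have h6 := (hframe (i + 1) (by omega)).1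
        rw [hA'] at h6
        have e1 : n₀ - 1 + ((i + 1 : ℕ) : ℤ) = n₀ + i := by push_cast; ring
        rw [e1] at h6
        rw [h3]
        exact (mul_eq_zero.1 h4.symm).resolve_right h6
  have hgap := hgap' l le_rfl
  have hQf : Q = conv I f s (n₀ - 1) := by
    have h := SupportedOn.toeplitzDet_mul_bot (I := I) (s := s) (p := f) (N := d) (a := 0)
      (c := n₀ - 1) (by rwa [zero_add]) (fun q h1 h2 => hgap q h1 (by omega)) rfl
    have h2 := hQ 0 (by omega)
    rw [hB', hB'] at h2
    simp only [sub_zero, zero_add, hf0, add_zero] at h h2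
    apply mul_right_cancel₀ hA0
    linear_combination h - h2
  have hRf : R * conv I f s (n₀ + l + d) = f d := by
    have h := SupportedOn.toeplitzDet_mul_top (I := I) (s := s) (p := f) (N := d) (a := 0)
      (c := n₀ + l) (by rwa [zero_add]) (fun q h1 h2 => hgap q (by omega) h2) rfl
    have h2 := hR l le_rfl
    have h3 := (hframe l (by omega)).2.2.1
    rw [hC' l (d + 1) (by omega)] at h2 h3
    rw [hC' (l + 1) d (by omega)] at h2
    simp only [sub_zero, zero_add] at h
    apply mul_right_cancel₀ h3
    linear_combination -h - conv I f s (n₀ + l + d) * h2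
  have hhi : conv I f s (n₀ + l + d) ≠ 0 := fun h => hfd (by rw [← hRf, h, mul_zero])
  have hlo : conv I f s (n₀ - 1) ≠ 0 := by
    rw [← hQf]
    rintro rfl
    have h2 := hQ 0 (by omega)
    rw [zero_mul] at h2
    exact (hframe 1 (by omega)).2.1 h2
  have hSf : S * conv I f s (n₀ + l + d) = (-1) ^ (d + l) * conv I f s (n₀ - 1) := by
    have hD0 := (hframe 0 (by omega)).2.2.2
    have hD1 := (hframe 1 (by omega)).2.2.2
    have hDS := hS 0 (by omega)
    rw [hD'] at hD0 hD1
    rw [hD', hD'] at hDS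
    simp only [zero_add, Nat.cast_one, Nat.cast_zero, sub_zero] at hD0 hD1 hDS
    obtain ⟨v, hv, hv0, hvs⟩ := exists_bot_one (I := I) s (d + l + 1) 0 (n₀ + l)
      (fun j h1 h2 => hI j (by omega) (by push_cast at h2; omega)) (by rwa [sub_zero])
    have h := hv.toeplitzDet_mul_of_conv_eq_zero hvs
    have h2 := hv.conv_eq_of_gap hgap (by omega) (n₀ + l + d) (by push_cast; omega) (by omega)
    rw [← conv_comm, conv, Finset.sum_eq_zero] at h2
    · have e1 : n₀ + l + d - (n₀ - 1) = 0 + ((d + l + 1 : ℕ) : ℤ) := by push_cast; ring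
      rw [sub_self, e1, hv0] at h2
      rw [sub_zero, hv0, hDS] at h
      have h3 : (1 : K) = (-1) ^ (d + l + 1) * v (0 + (d + l + 1 : ℕ)) * S := by
        apply mul_right_cancel₀ hD0
        linear_combination h
      have h4 : ((-1 : K) ^ (d + l)) * (-1) ^ (d + l) = 1 := by
        rw [← mul_pow]
        simp
      rw [pow_succ] at h3
      linear_combination -S * h2 - (-1) ^ (d + l) * conv I f s (n₀ - 1) * h3 +
        S * v (0 + (d + l + 1 : ℕ)) * conv I f s (n₀ - 1) * h4
    · intro j _
      by_cases hj : j < 0 ∨ (d : ℤ) < j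
      · rw [hf.2 j hj, zero_mul]
      · rw [hvs _ (by omega) (by push_cast; omega), mul_zero]
  obtain ⟨hAk, hBk, hCk, hDk⟩ := hframe k hk
  obtain ⟨M, hM⟩ : ∃ M, M + k = d + l + 1 := ⟨d + l + 1 - k, by omega⟩
  have hM' : (k - 1 - l : ℤ) + M = d := by omega
  obtain ⟨x, hx, hxt, hxs⟩ := exists_top_one (I := I) s (d + k) 0 (n₀ - 1)
    (fun j h1 h2 => hI j (by omega) (by push_cast at h2; omega)) (by rwa [sub_zero, ← hB'])
  have hxF := hx.toeplitzDet_mul_of_conv_eq_zero hxs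
  have e1 : n₀ + k - (k - 1 - l) - 1 = n₀ + l := by ring
  obtain ⟨y, hy, hyb, hys⟩ := exists_bot_one (I := I) s M (k - 1 - l) (n₀ + k)
    (fun j h1 h2 => hI j (by omega) (by omega)) (by rwa [e1, ← hC' k M hM])
  have hyG := hy.toeplitzDet_mul_of_conv_eq_zero hys
  have e2 : n₀ + k - (k - 1 - l) = n₀ + l + 1 := by ring
  have e3 : n₀ - 1 - 1 = n₀ - 2 := by ring
  rw [hxt, sub_zero, e3, ← hB', ← hF'] at hxF
  rw [e1, e2, hyb, hM', ← hC' k M hM, ← hG' M hM] at hyG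
  rw [hM'] at hy
  simp only [zero_add, Nat.cast_add] at hx hxt
  have hmain := toeplitzDet_outer_bottom hk hf hf0 hfd hgap hlo hhi
    (fun j h1 h2 => hI j (by omega) (by omega)) hx hxt
    (fun q h1 h2 => hxs q h1 (by push_cast; omega)) hy hyb
    (fun q h1 h2 => hys q h1 (by omega)) (by rwa [← hA'])
  rw [← hH', ← hD', ← hA', ← hE] at hmain
  have hsign : ((-1 : K) ^ M) = -(-1) ^ (d + l) * (-1) ^ k := by
    have h := congrArg (fun i => (-1 : K) ^ i * (-1) ^ k) hM
    have h4 : ((-1 : K) ^ k) * (-1) ^ k = 1 := by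
      rw [← mul_pow]
      simp
    simp only [pow_add, pow_one] at h ⊢
    linear_combination h - (-1) ^ M * h4
  have hx0 : x 0 = (-1) ^ d * (-1) ^ k * F k / B k := by
    rw [eq_div_iff hBk]
    linear_combination hxF + F k * pow_add (-1 : K) d k
  have hyd : y d = -(-1) ^ (d + l) * (-1) ^ k * G k / C k := by
    have h4 : ((-1 : K) ^ M) * (-1) ^ M = 1 := by
      rw [← mul_pow]
      simp
    rw [eq_div_iff hCk, ← hsign]
    linear_combination -(-1) ^ M * hyG - y d * C k * h4
  have hSf' : S = (-1) ^ (d + l) * conv I f s (n₀ - 1) / conv I f s (n₀ + l + d) :=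
    (eq_div_iff hhi).2 hSf
  have hRf' : R = f d / conv I f s (n₀ + l + d) := (eq_div_iff hhi).2 hRf
  rw [hmain, hx0, hyd, hSf', hRf', hPf, hQf]
  field_simp
  ring
end
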